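/- For each ε ∈ {+1,−1} there exist functions G₀^ε(s;ξ) and G₁^ε(s;ξ), defined for s > 0 and ξ ∈ [0,1], such that for every fixed s > 0 and ξ ∈ [0,1]: (i) G_N^ε(s;ξ) → G₀^ε(s;ξ) as N → ∞; (ii) N²(G_N^ε(s;ξ) − G₀^ε(s;ξ)) → G₁^ε(s;ξ) as N → ∞; (iii) s ↦ G₀^ε(s;ξ) is twice differentiable; and (iv) G₁^ε(s;ξ) = −(s²/6)·∂²G₀^ε(s;ξ)/∂s². -/

import Mathlib

open MeasureTheory Real Filter Topology

/-- The scaled CUE kernel `k_N(u) = sin(πu/2)/(2π sin(πu/(2N)))`, with the convention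
`k_N(0) = N/(2π)`. -/
noncomputable def kN (N : ℕ) (u : ℝ) : ℝ :=
  if u = 0 then N / (2 * π) else Real.sin (π * u / 2) / (2 * π * Real.sin (π * u / (2 * N)))

/-- The scaled orthogonal-group kernel `κ_N^ε(x,y) = (π/N)(k_N(x−y) + ε k_N(x+y))`. -/
noncomputable def orthKernel (ε : ℝ) (N : ℕ) (x y : ℝ) : ℝ :=
  (π / N) * (kN N (x - y) + ε * kN N (x + y))

/-- The gap probability generating function
`G_N^ε(s;ξ) = Σ_k ((−ξ)^k/k!) ∫_{(0,s)^k} det[κ_N^ε(x_i,x_j)] dx`. -/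
noncomputable def orthGapGF (ε : ℝ) (N : ℕ) (s ξ : ℝ) : ℝ :=
  ∑' k : ℕ, ((-ξ) ^ k / (Nat.factorial k : ℝ)) *
    ∫ x in Set.univ.pi fun _ : Fin k => Set.Ioo (0 : ℝ) s,
      (Matrix.of fun i j : Fin k => orthKernel ε N (x i) (x j)).det


/-- Hadamard's determinant inequality with a sup bound on each row. -/
lemma hadamard_rows {k : ℕ} (A : Matrix (Fin k) (Fin k) ℝ) (M : Fin k → ℝ)
    (hM : ∀ i j, |A i j| ≤ M i) (hM0 : ∀ i, 0 ≤ M i) :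
    |A.det| ≤ √(k : ℝ) ^ k * ∏ i, M i := by
  let b := EuclideanSpace.basisFun (Fin k) ℝ
  have : Fact (Module.finrank ℝ (EuclideanSpace ℝ (Fin k)) = k) := ⟨by simp⟩
  let v : Fin k → EuclideanSpace ℝ (Fin k) := fun i => WithLp.toLp 2 (A i)
  have h1 := (b.toBasis.orientation).abs_volumeForm_apply_le v
  rw [(b.toBasis.orientation).volumeForm_robust' b] at h1
  have h2 : b.toBasis.det v = A.det := by
    rw [Module.Basis.det_apply, ← Matrix.det_transpose]
    congr 1
  rw [h2] at h1
  refine h1.trans ?_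
  have h3 : √(k : ℝ) ^ k * ∏ i, M i = ∏ i : Fin k, (√(k : ℝ) * M i) := by
    rw [Finset.prod_mul_distrib]; simp
  rw [h3]
  refine Finset.prod_le_prod (fun _ _ => norm_nonneg _) fun i _ => ?_
  rw [EuclideanSpace.norm_eq]
  rw [← Real.sqrt_sq (hM0 i), ← Real.sqrt_mul (by positivity)]
  apply Real.sqrt_le_sqrt
  calc ∑ j, ‖v i j‖ ^ 2 ≤ ∑ j : Fin k, M i ^ 2 := by
        refine Finset.sum_le_sum fun j _ => ?_
        exact pow_le_pow_left₀ (norm_nonneg _) (hM i j) 2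
    _ = _ := by simp

/-- Continuous kernels on the unit square. -/
abbrev Ker := C(unitInterval × unitInterval, ℝ)

/-- Projection to the unit interval. -/
noncomputable def prI (x : ℝ) : unitInterval := Set.projIcc 0 1 zero_le_one x

lemma continuous_prI : Continuous prI := continuous_projIcc (h := zero_le_one)

/-- The open unit box. -/
def box (k : ℕ) : Set (Fin k → ℝ) := Set.univ.pi fun _ : Fin k => Set.Ioo (0 : ℝ) 1

/-- Determinant whose row `i` is taken from the kernel `K i`, as a multilinear map. -/
noncomputable def detMulti (k : ℕ) (x : Fin k → ℝ) : MultilinearMap ℝ (fun _ : Fin k => Ker) ℝ :=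
  (Matrix.detRowAlternating (R := ℝ) (n := Fin k)).toMultilinearMap.compLinearMap
    (fun i => { toFun := fun K : Ker => fun j : Fin k => K (prI (x i), prI (x j))
                map_add' := fun _ _ => rfl
                map_smul' := fun _ _ => rfl })

lemma detMulti_apply (k : ℕ) (x : Fin k → ℝ) (K : Fin k → Ker) :
    detMulti k x K = (Matrix.of fun i j : Fin k => K i (prI (x i), prI (x j))).det := rfl

lemma continuous_detMulti (k : ℕ) (K : Fin k → Ker) : Continuous fun x => detMulti k x K := by
  simp only [detMulti_apply]
  refine Continuous.matrix_det ?_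
  refine continuous_matrix fun i j => ?_
  simp only [Matrix.of_apply]
  exact (K i).continuous.comp ((continuous_prI.comp (continuous_apply i)).prodMk
    (continuous_prI.comp (continuous_apply j)))

lemma abs_detMulti_le (k : ℕ) (x : Fin k → ℝ) (K : Fin k → Ker) :
    |detMulti k x K| ≤ √(k : ℝ) ^ k * ∏ i, ‖K i‖ := by
  rw [detMulti_apply]
  exact hadamard_rows _ _ (fun i j => (K i).norm_coe_le_norm _) fun i => norm_nonneg _

lemma volume_box (k : ℕ) : volume (box k) = 1 := by
  rw [box, Real.volume_pi_Ioo]; simp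

lemma integrable_detMulti (k : ℕ) (K : Fin k → Ker) :
    IntegrableOn (fun x => detMulti k x K) (box k) := by
  refine Measure.integrableOn_of_bounded (M := √(k : ℝ) ^ k * ∏ i, ‖K i‖) (by simp [volume_box])
    (continuous_detMulti k K).aestronglyMeasurable ?_
  exact Eventually.of_forall fun x => abs_detMulti_le k x K

/-- The multilinear Fredholm term. -/
noncomputable def fredMulti (k : ℕ) : ContinuousMultilinearMap ℝ (fun _ : Fin k => Ker) ℝ :=
  MultilinearMap.mkContinuous
    { toFun := fun K => ∫ x in box k, detMulti k x K
      map_update_add' := by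
        intro _ K i a b
        have : ∀ (x : Fin k → ℝ) (c : Ker), detMulti k x (Function.update K i c) =
          detMulti k x (Function.update K i c) := fun _ _ => rfl
        rw [← integral_add (integrable_detMulti k _) (integrable_detMulti k _)]
        refine integral_congr_ae (Eventually.of_forall fun x => ?_)
        exact (detMulti k x).map_update_add K i a b
      map_update_smul' := by
        intro _ K i c a
        rw [← integral_smul]
        refine integral_congr_ae (Eventually.of_forall fun x => ?_)
        exact (detMulti k x).map_update_smul K i c a }
    (√(k : ℝ) ^ k) (by
      intro K
      have := norm_setIntegral_le_of_norm_le_const (μ := volume) (s := box k)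
        (f := fun x => detMulti k x K) (by simp [volume_box]) (fun x _ => abs_detMulti_le k x K)
      simpa [Measure.real, volume_box] using this)

lemma fredMulti_apply (k : ℕ) (K : Fin k → Ker) :
    fredMulti k K = ∫ x in box k, detMulti k x K := rfl

lemma norm_fredMulti_le (k : ℕ) : ‖fredMulti k‖ ≤ √(k : ℝ) ^ k :=
  MultilinearMap.mkContinuous_norm_le _ (by positivity) _

lemma summable_fred (y : ℝ) : Summable fun k : ℕ => √(k : ℝ) ^ k * y ^ k / (Nat.factorial k : ℝ) := by
  have h1 : Summable fun k : ℕ => (4 * y ^ 2 * Real.exp 1) ^ k / (Nat.factorial k : ℝ) :=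
    Real.summable_pow_div_factorial _
  have h2 : Summable fun k : ℕ => (1 / 4 : ℝ) ^ k :=
    summable_geometric_of_lt_one (by norm_num) (by norm_num)
  refine Summable.of_norm_bounded (h1.add h2) fun k => ?_
  have hf : (0 : ℝ) < Nat.factorial k := by positivity
  have h3 : (k : ℝ) ^ k / (Nat.factorial k : ℝ) ≤ Real.exp 1 ^ k := by
    rw [← Real.exp_nat_mul, mul_one]
    exact Real.pow_div_factorial_le_exp (k : ℝ) (by positivity) k
  set A : ℝ := √(k : ℝ) ^ k * (2 * y) ^ k / (Nat.factorial k : ℝ) with hA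
  have e1 : √(k : ℝ) ^ k * y ^ k / (Nat.factorial k : ℝ) = A * (1 / 2) ^ k := by
    rw [hA, mul_pow, one_div, inv_pow]; field_simp
  have e2 : A ^ 2 ≤ (4 * y ^ 2 * Real.exp 1) ^ k / (Nat.factorial k : ℝ) := by
    have : A ^ 2 = ((4 * y ^ 2) ^ k / (Nat.factorial k : ℝ)) *
        ((k : ℝ) ^ k / (Nat.factorial k : ℝ)) := by
      rw [hA, div_pow, mul_pow, ← pow_mul, mul_comm k 2, pow_mul, Real.sq_sqrt (by positivity),
        ← pow_mul, mul_comm k 2, pow_mul (2 * y)]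
      rw [show (2 * y) ^ 2 = 4 * y ^ 2 by ring]
      field_simp
    rw [this, mul_pow (4 * y ^ 2), mul_div_right_comm]
    exact mul_le_mul_of_nonneg_left h3 (by positivity)
  have e3 : ((1 / 2 : ℝ) ^ k) ^ 2 = (1 / 4) ^ k := by
    rw [← pow_mul, mul_comm, pow_mul]; norm_num
  rw [e1, ← e3, Real.norm_eq_abs]
  refine le_trans ?_ (add_le_add_left e2 _)
  set B := (1 / 2 : ℝ) ^ k
  rw [abs_le]
  constructor <;> nlinarith [sq_nonneg (A + B), sq_nonneg (A - B), sq_nonneg A, sq_nonneg B]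

/-- The Fredholm series. -/
noncomputable def fredSeries (ξ : ℝ) : FormalMultilinearSeries ℝ Ker ℝ :=
  fun k => ((-ξ) ^ k / (Nat.factorial k : ℝ)) • fredMulti k

lemma radius_fredSeries (ξ : ℝ) : (fredSeries ξ).radius = ⊤ := by
  refine FormalMultilinearSeries.radius_eq_top_of_summable_norm _ fun r => ?_
  refine Summable.of_nonneg_of_le (fun k => by positivity) (fun k => ?_)
    (summable_fred (|ξ| * r))
  rw [fredSeries, norm_smul, norm_div, norm_pow, norm_neg, Real.norm_eq_abs]
  have : ‖(Nat.factorial k : ℝ)‖ = Nat.factorial k := by simp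
  rw [this, mul_pow]
  calc _ ≤ |ξ| ^ k / (Nat.factorial k : ℝ) * √(k : ℝ) ^ k * (r : ℝ) ^ k := by
        gcongr; exact norm_fredMulti_le k
    _ = _ := by ring

/-- The Fredholm determinant. -/
noncomputable def fred (ξ : ℝ) : Ker → ℝ := (fredSeries ξ).sum

lemma fred_eq (ξ : ℝ) (K : Ker) : fred ξ K = ∑' k : ℕ, ((-ξ) ^ k / (Nat.factorial k : ℝ)) *
    ∫ x in box k, (Matrix.of fun i j : Fin k => K (prI (x i), prI (x j))).det := rfl

lemma hasFPS (ξ : ℝ) : HasFPowerSeriesOnBall (fred ξ) (fredSeries ξ) 0 ⊤ := by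
  have := (fredSeries ξ).hasFPowerSeriesOnBall (by simp [radius_fredSeries])
  rwa [radius_fredSeries] at this

lemma hasSum_fred (ξ : ℝ) (K : Ker) : HasSum (fun k : ℕ => ((-ξ) ^ k / (Nat.factorial k : ℝ)) *
    ∫ x in box k, detMulti k x (fun _ => K)) (fred ξ K) := by
  have := (hasFPS ξ).hasSum (y := K) (by simp)
  rw [zero_add] at this
  exact this

lemma contDiff_fred (ξ : ℝ) : ContDiff ℝ 2 (fred ξ) := by
  have h : AnalyticOnNhd ℝ (fred ξ) Set.univ := by
    have := (hasFPS ξ).analyticOnNhd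
    simpa using this
  exact (contDiffOn_univ.1 (h.contDiffOn (uniqueDiffOn_univ)))

lemma det_rank_one_affine {k : ℕ} (A : Matrix (Fin k) (Fin k) ℝ) (u v : Fin k → ℝ) (t : ℝ) :
    (A + t • Matrix.vecMulVec u v).det =
      (1 - t) * A.det + t * (A + Matrix.vecMulVec u v).det := by
  have key : ∀ t : ℝ, (A + t • Matrix.vecMulVec u v).det =
      (Matrix.fromBlocks (1 : Matrix Unit Unit ℝ) (Matrix.replicateRow Unit (-t • v))
        (Matrix.replicateCol Unit u) A).det := by
    intro t
    rw [Matrix.det_fromBlocks_one₁₁]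
    congr 1
    ext i j
    simp [Matrix.vecMulVec_apply, Matrix.mul_apply]
    ring
  let B := Matrix.fromBlocks (1 : Matrix Unit Unit ℝ) (0 : Matrix Unit (Fin k) ℝ)
        (Matrix.replicateCol Unit u) A
  let r : ℝ → (Unit ⊕ Fin k → ℝ) := fun t => Sum.elim (fun _ => 1) (-t • v)
  have key2 : ∀ t : ℝ, (A + t • Matrix.vecMulVec u v).det =
      (B.updateRow (Sum.inl ()) (r t)).det := by
    intro t
    rw [key]
    congr 1
    ext i j
    rcases i with i | i <;> rcases j with j | j <;> simp [B, r, Matrix.updateRow_apply]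
  have h0 := key2 0
  have h1 := key2 1
  simp only [zero_smul, add_zero, one_smul] at h0 h1
  rw [key2, h0, h1, ← Matrix.det_updateRow_smul, ← Matrix.det_updateRow_smul,
    ← Matrix.det_updateRow_add]
  congr 2
  ext j
  rcases j with j | j <;> simp [r]

lemma fred_rank_one (ξ : ℝ) (K C : Ker) (u v : unitInterval → ℝ)
    (hC : ∀ p, C p = u p.1 * v p.2) (t : ℝ) :
    fred ξ (K + t • C) = (1 - t) * fred ξ K + t * fred ξ (K + C) := by
  refine (hasSum_fred ξ (K + t • C)).unique ?_
  have := ((hasSum_fred ξ K).mul_left (1 - t)).add ((hasSum_fred ξ (K + C)).mul_left t)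
  refine Eq.mp (congrArg (fun f => HasSum f _) (funext fun k => ?_)) this
  have h : ∀ x, detMulti k x (fun _ => K + t • C) = (1 - t) * detMulti k x (fun _ => K)
      + t * detMulti k x (fun _ => K + C) := by
    intro x
    have := det_rank_one_affine (Matrix.of fun i j : Fin k => K (prI (x i), prI (x j)))
      (fun i => u (prI (x i))) (fun j => v (prI (x j))) t
    simp only [detMulti_apply]
    convert this using 3
    · ext i j; simp [hC, Matrix.vecMulVec_apply]
    · congr 1
      ext i j; simp [hC, Matrix.vecMulVec_apply]
  simp only [h]
  rw [integral_add ((integrable_detMulti k _).const_mul _) ((integrable_detMulti k _).const_mul _),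
    integral_const_mul, integral_const_mul]
  ring

lemma hasFDerivAt_fred (ξ : ℝ) (K : Ker) : HasFDerivAt (fred ξ) (fderiv ℝ (fred ξ) K) K :=
  (((contDiff_fred ξ).differentiable (by norm_num)) K).hasFDerivAt

lemma hasFDerivAt_fderiv_fred (ξ : ℝ) (K : Ker) :
    HasFDerivAt (fderiv ℝ (fred ξ)) (fderiv ℝ (fderiv ℝ (fred ξ)) K) K := by
  have : ContDiff ℝ 1 (fderiv ℝ (fred ξ)) := (contDiff_fred ξ).fderiv_right (by norm_num)
  exact ((this.differentiable (by norm_num)) K).hasFDerivAt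

lemma second_fderiv_rank_one (ξ : ℝ) (K C : Ker) (u v : unitInterval → ℝ)
    (hC : ∀ p, C p = u p.1 * v p.2) : fderiv ℝ (fderiv ℝ (fred ξ)) K C C = 0 := by
  have hline : ∀ t : ℝ, HasDerivAt (fun t : ℝ => K + t • C) C t := by
    intro t
    simpa using ((hasDerivAt_id t).smul_const C).const_add K
  have h1 : ∀ t : ℝ, fderiv ℝ (fred ξ) (K + t • C) C = fred ξ (K + C) - fred ξ K := by
    intro t
    have a := (hasFDerivAt_fred ξ (K + t • C)).comp_hasDerivAt t (hline t)
    have b : HasDerivAt (fun t : ℝ => (1 - t) * fred ξ K + t * fred ξ (K + C))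
        (-1 * fred ξ K + 1 * fred ξ (K + C)) t :=
      (((hasDerivAt_id t).const_sub 1).mul_const _).add ((hasDerivAt_id t).mul_const _)
    have e : (fred ξ ∘ fun t : ℝ => K + t • C) =
        fun t : ℝ => (1 - t) * fred ξ K + t * fred ξ (K + C) := by
      ext t; exact fred_rank_one ξ K C u v hC t
    rw [e] at a
    rw [a.unique b]; ring
  have h2 : HasDerivAt (fun t : ℝ => fderiv ℝ (fred ξ) (K + t • C) C)
      (fderiv ℝ (fderiv ℝ (fred ξ)) (K + (0 : ℝ) • C) C C) 0 := by
    have := HasFDerivAt.comp_hasDerivAt (f := fun t : ℝ => K + t • C) (l := fderiv ℝ (fred ξ))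
      (0 : ℝ) (hasFDerivAt_fderiv_fred ξ (K + (0 : ℝ) • C)) (hline 0)
    have h3 := this.clm_apply (hasDerivAt_const (0 : ℝ) C)
    simpa using h3
  simp only [h1] at h2
  have := h2.unique (hasDerivAt_const _ _)
  simpa using this

lemma hasDerivAt_ker (f f' : ℝ → Ker) (hf' : Continuous f')
    (h : ∀ p t, HasDerivAt (fun t => f t p) (f' t p) t) (t : ℝ) : HasDerivAt f (f' t) t := by
  have e : f = fun t => f 0 + ∫ u in (0 : ℝ)..t, f' u := by
    ext t p
    have h1 := (ContinuousMap.evalCLM ℝ p : Ker →L[ℝ] ℝ).intervalIntegral_comp_comm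
      (hf'.intervalIntegrable (μ := volume) 0 t)
    have h2 := intervalIntegral.integral_eq_sub_of_hasDerivAt (fun u _ => h p u)
      (((ContinuousMap.evalCLM ℝ p : Ker →L[ℝ] ℝ).continuous.comp hf').intervalIntegrable
        (μ := volume) 0 t)
    simp only [ContinuousMap.evalCLM_apply] at h1
    simp only [ContinuousMap.add_apply, ← h1]
    rw [h2]; ring
  rw [e]
  exact (intervalIntegral.integral_hasDerivAt_right (hf'.intervalIntegrable _ _)
    (hf'.stronglyMeasurableAtFilter _ _) hf'.continuousAt).const_add _

/-- The kernel `g s (x - y) + ε g s (x + y)` on the unit square. -/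
noncomputable def mkKer (ε : ℝ) (g : ℝ → ℝ → ℝ) (hg : Continuous (Function.uncurry g)) (s : ℝ) :
    Ker where
  toFun p := g s ((p.1 : ℝ) - p.2) + ε * g s ((p.1 : ℝ) + p.2)
  continuous_toFun := by
    have h1 : Continuous fun p : unitInterval × unitInterval => (s, (p.1 : ℝ) - p.2) := by fun_prop
    have h2 : Continuous fun p : unitInterval × unitInterval => (s, (p.1 : ℝ) + p.2) := by fun_prop
    exact (hg.comp h1).add (continuous_const.mul (hg.comp h2))

lemma mkKer_apply (ε : ℝ) (g : ℝ → ℝ → ℝ) (hg : Continuous (Function.uncurry g)) (s : ℝ)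
    (p : unitInterval × unitInterval) :
    mkKer ε g hg s p = g s ((p.1 : ℝ) - p.2) + ε * g s ((p.1 : ℝ) + p.2) := rfl

lemma continuous_mkKer (ε : ℝ) (g : ℝ → ℝ → ℝ) (hg : Continuous (Function.uncurry g)) :
    Continuous (mkKer ε g hg) := by
  refine ContinuousMap.continuous_of_continuous_uncurry _ ?_
  have h1 : Continuous fun q : ℝ × (unitInterval × unitInterval) =>
    (q.1, (q.2.1 : ℝ) - q.2.2) := by fun_prop
  have h2 : Continuous fun q : ℝ × (unitInterval × unitInterval) =>
    (q.1, (q.2.1 : ℝ) + q.2.2) := by fun_prop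
  exact (hg.comp h1).add (continuous_const.mul (hg.comp h2))

lemma hasDerivAt_mkKer (ε : ℝ) (g g' : ℝ → ℝ → ℝ) (hg : Continuous (Function.uncurry g))
    (hg' : Continuous (Function.uncurry g'))
    (h : ∀ a s, HasDerivAt (fun s => g s a) (g' s a) s) (s : ℝ) :
    HasDerivAt (mkKer ε g hg) (mkKer ε g' hg' s) s := by
  refine hasDerivAt_ker _ _ (continuous_mkKer ε g' hg') (fun p t => ?_) s
  simp only [mkKer_apply]
  exact (h _ t).add ((h _ t).const_mul ε)

/-- Limit kernel profile. -/
noncomputable def g0 (s a : ℝ) : ℝ := s / 2 * Real.sinc (π * s * a / 2)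
/-- First derivative profile. -/
noncomputable def g1 (s a : ℝ) : ℝ := 1 / 2 * Real.cos (π * s * a / 2)
/-- Second derivative profile. -/
noncomputable def g2 (s a : ℝ) : ℝ := -(π * a / 4) * Real.sin (π * s * a / 2)
/-- Finite `N` kernel profile. -/
noncomputable def gN (N : ℕ) (s a : ℝ) : ℝ :=
  s / 2 * Real.sinc (π * s * a / 2) / max (1 / 2) (Real.sinc (π * s * a / 2 / N))

lemma cont_g0 : Continuous (Function.uncurry g0) := by
  have : Continuous fun q : ℝ × ℝ => q.1 / 2 * Real.sinc (π * q.1 * q.2 / 2) :=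
    (by fun_prop : Continuous fun q : ℝ × ℝ => q.1 / 2).mul
      (Real.continuous_sinc.comp (by fun_prop))
  exact this

lemma cont_g1 : Continuous (Function.uncurry g1) := by
  have : Continuous fun q : ℝ × ℝ => 1 / 2 * Real.cos (π * q.1 * q.2 / 2) := by fun_prop
  exact this

lemma cont_g2 : Continuous (Function.uncurry g2) := by
  have : Continuous fun q : ℝ × ℝ => -(π * q.2 / 4) * Real.sin (π * q.1 * q.2 / 2) := by fun_prop
  exact this

lemma cont_gN (N : ℕ) : Continuous (Function.uncurry (gN N)) := by
  have h2 : Continuous fun q : ℝ × ℝ => max (1 / 2) (Real.sinc (π * q.1 * q.2 / 2 / N)) :=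
    continuous_const.max (Real.continuous_sinc.comp (by fun_prop))
  exact cont_g0.div h2 fun q => (lt_of_lt_of_le (by norm_num) (le_max_left _ _)).ne'

lemma mul_sinc (x : ℝ) : x * Real.sinc x = Real.sin x := by
  by_cases h : x = 0
  · simp [h]
  · rw [Real.sinc_of_ne_zero h]; field_simp

lemma deriv_g0 (a s : ℝ) : HasDerivAt (fun s => g0 s a) (g1 s a) s := by
  by_cases h : a = 0
  · subst h
    simp only [g0, g1, mul_zero, zero_div, Real.sinc_zero, Real.cos_zero, mul_one]
    exact (hasDerivAt_id s).div_const 2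
  · have e : (fun s => g0 s a) = fun s => Real.sin (π * s * a / 2) / (π * a) := by
      ext s
      rw [g0, ← mul_sinc]; field_simp
    rw [e]
    have h1 : HasDerivAt (fun s : ℝ => π * s * a / 2) (π * 1 * a / 2) s :=
      (((hasDerivAt_id s).const_mul π).mul_const a).div_const 2
    refine (h1.sin.div_const (π * a)).congr_deriv ?_
    rw [g1]; field_simp

lemma deriv_g1 (a s : ℝ) : HasDerivAt (fun s => g1 s a) (g2 s a) s := by
  have h1 : HasDerivAt (fun s : ℝ => π * s * a / 2) (π * 1 * a / 2) s :=
    (((hasDerivAt_id s).const_mul π).mul_const a).div_const 2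
  refine (h1.cos.const_mul (1 / 2)).congr_deriv ?_
  rw [g2]; ring

lemma sinc_remainder (w : ℝ) (hw : |w| ≤ 1) : |Real.sinc w - (1 - w ^ 2 / 6)| ≤ w ^ 4 / 100 := by
  by_cases h : w = 0
  · simp [h]
  · have := Real.sin_bound hw
    have hp : 0 < |w| := abs_pos.2 h
    rw [← mul_sinc, show w * Real.sinc w - (w - w ^ 3 / 6) =
      w * (Real.sinc w - (1 - w ^ 2 / 6)) by ring, abs_mul] at this
    have e : |w| ^ 5 / 100 = |w| * (w ^ 4 / 100) := by
      have : w ^ 4 = |w| ^ 4 := by rw [← abs_pow]; exact (abs_of_nonneg (by positivity)).symm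
      rw [this]; ring
    rw [e] at this
    exact le_of_mul_le_mul_left this hp

lemma sinc_ge_half (w : ℝ) (hw : |w| ≤ 1) : 1 / 2 ≤ Real.sinc w := by
  have h := (abs_le.1 (sinc_remainder w hw)).1
  have h2 : w ^ 2 ≤ 1 := by rw [← sq_abs]; exact pow_le_one₀ (abs_nonneg _) hw
  nlinarith [sq_nonneg (w ^ 2), sq_nonneg w]

lemma inv_sinc_bound (w : ℝ) (hw : |w| ≤ 1) : |1 / Real.sinc w - 1 - w ^ 2 / 6| ≤ w ^ 4 := by
  have h := sinc_remainder w hw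
  have hh := sinc_ge_half w hw
  have h2 : w ^ 2 ≤ 1 := by rw [← sq_abs]; exact pow_le_one₀ (abs_nonneg _) hw
  set σ := Real.sinc w
  obtain ⟨r, hr⟩ : ∃ r, r = σ - (1 - w ^ 2 / 6) := ⟨_, rfl⟩
  rw [← hr] at h
  have hσ : 0 < σ := by linarith
  have e : 1 / σ - 1 - w ^ 2 / 6 = (w ^ 4 / 36 - r * (1 + w ^ 2 / 6)) / σ := by
    have : σ = 1 - w ^ 2 / 6 + r := by linarith
    field_simp
    rw [this]; ring
  rw [e, abs_div, abs_of_pos hσ, div_le_iff₀ hσ]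
  have h3 : |w ^ 4 / 36 - r * (1 + w ^ 2 / 6)| ≤ w ^ 4 / 36 + w ^ 4 / 100 * 2 := by
    refine (abs_sub _ _).trans ?_
    rw [abs_of_nonneg (by positivity : 0 ≤ w ^ 4 / 36), abs_mul,
      abs_of_nonneg (by positivity : 0 ≤ 1 + w ^ 2 / 6)]
    gcongr
    linarith
  nlinarith [sq_nonneg (w ^ 2), mul_le_mul_of_nonneg_left hh (by positivity : 0 ≤ w ^ 4)]

lemma profile_bound (N : ℕ) (s a : ℝ) (hs : 0 < s) (hN : π * s ≤ N) (ha : |a| ≤ 2) :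
    |(N : ℝ) ^ 2 * (gN N s a - g0 s a) + s ^ 2 / 6 * g2 s a| ≤ s / 2 * (π * s) ^ 4 / (N : ℝ) ^ 2 := by
  have hps : 0 < π * s := by positivity
  have hN0 : (0 : ℝ) < N := lt_of_lt_of_le hps hN
  set b := π * s * a / 2 with hb
  have hbb : |b| ≤ π * s := by
    rw [hb, abs_div, abs_mul, abs_of_pos hps, abs_of_pos (by norm_num : (0 : ℝ) < 2)]
    nlinarith
  have hw : |b / N| ≤ 1 := by
    rw [abs_div, abs_of_pos hN0, div_le_one hN0]; linarith
  have h1 := inv_sinc_bound _ hw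
  have hm : max (1 / 2) (Real.sinc (b / N)) = Real.sinc (b / N) := max_eq_right (sinc_ge_half _ hw)
  have e : (N : ℝ) ^ 2 * (gN N s a - g0 s a) + s ^ 2 / 6 * g2 s a =
      s / 2 * Real.sinc b * ((N : ℝ) ^ 2 * (1 / Real.sinc (b / N) - 1 - (b / N) ^ 2 / 6)) := by
    rw [gN, g0, g2, ← hb, hm, ← mul_sinc b, hb]
    field_simp
    ring
  rw [e, abs_mul, abs_mul, abs_mul, abs_of_pos (by positivity : 0 < s / 2),
    abs_of_pos (by positivity : 0 < (N : ℝ) ^ 2)]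
  have hb4 : b ^ 4 ≤ (π * s) ^ 4 := by
    have : b ^ 4 = |b| ^ 4 := by rw [← abs_pow]; exact (abs_of_nonneg (by positivity)).symm
    rw [this]; gcongr
  calc _ ≤ s / 2 * 1 * ((N : ℝ) ^ 2 * (b / N) ^ 4) := by
        gcongr; exact Real.abs_sinc_le_one b
    _ = s / 2 * b ^ 4 / (N : ℝ) ^ 2 := by field_simp
    _ ≤ _ := by gcongr

lemma tendsto_ker (ε s : ℝ) (hs : 0 < s) :
    Tendsto (fun N : ℕ => ((N : ℝ) ^ 2) • (mkKer ε (gN N) (cont_gN N) s - mkKer ε g0 cont_g0 s))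
      atTop (𝓝 (-(s ^ 2 / 6) • mkKer ε g2 cont_g2 s)) := by
  rw [tendsto_iff_norm_sub_tendsto_zero]
  set C := (1 + |ε|) * (s / 2 * (π * s) ^ 4) with hC
  have hlim : Tendsto (fun N : ℕ => C * ((N : ℝ) ^ 2)⁻¹) atTop (𝓝 0) := by
    have : Tendsto (fun N : ℕ => ((N : ℝ) ^ 2)⁻¹) atTop (𝓝 0) :=
      tendsto_inv_atTop_zero.comp ((tendsto_pow_atTop (by norm_num)).comp
        tendsto_natCast_atTop_atTop)
    simpa using this.const_mul C
  refine squeeze_zero' (Eventually.of_forall fun _ => norm_nonneg _) ?_ hlim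
  filter_upwards [tendsto_natCast_atTop_atTop.eventually_ge_atTop (π * s)] with N hN
  rw [ContinuousMap.norm_le _ (by positivity)]
  rintro ⟨x, y⟩
  have hx := x.2
  have hy := y.2
  rw [Set.mem_Icc] at hx hy
  have ba := profile_bound N s ((x : ℝ) - y) hs hN (by rw [abs_le]; constructor <;> linarith)
  have bb := profile_bound N s ((x : ℝ) + y) hs hN (by rw [abs_le]; constructor <;> linarith)
  simp only [ContinuousMap.sub_apply, ContinuousMap.smul_apply, mkKer_apply, smul_eq_mul,
    Real.norm_eq_abs]
  set A := (N : ℝ) ^ 2 * (gN N s ((x : ℝ) - y) - g0 s ((x : ℝ) - y)) +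
    s ^ 2 / 6 * g2 s ((x : ℝ) - y)
  set B := (N : ℝ) ^ 2 * (gN N s ((x : ℝ) + y) - g0 s ((x : ℝ) + y)) +
    s ^ 2 / 6 * g2 s ((x : ℝ) + y)
  calc _ = |A + ε * B| := by congr 1; simp only [A, B]; ring
    _ ≤ |A| + |ε| * |B| := by rw [← abs_mul]; exact abs_add_le _ _
    _ ≤ s / 2 * (π * s) ^ 4 / (N : ℝ) ^ 2 + |ε| * (s / 2 * (π * s) ^ 4 / (N : ℝ) ^ 2) := by gcongr
    _ = _ := by rw [hC]; ring

lemma kN_profile (N : ℕ) (s a : ℝ) (hs : 0 < s) (hN : π * s ≤ N) (ha : |a| ≤ 2) :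
    s * ((π / N) * kN N (s * a)) = gN N s a := by
  have hps : 0 < π * s := by positivity
  have hN0 : (0 : ℝ) < N := lt_of_lt_of_le hps hN
  set b := π * s * a / 2 with hb
  have hbb : |b| ≤ π * s := by
    rw [hb, abs_div, abs_mul, abs_of_pos hps, abs_of_pos (by norm_num : (0 : ℝ) < 2)]
    nlinarith
  have hw : |b / N| ≤ 1 := by
    rw [abs_div, abs_of_pos hN0, div_le_one hN0]; linarith
  have hh := sinc_ge_half _ hw
  have hm : max (1 / 2) (Real.sinc (b / N)) = Real.sinc (b / N) := max_eq_right hh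
  rw [gN, ← hb, hm]
  by_cases h : a = 0
  · have hb0 : b = 0 := by rw [hb, h]; simp
    rw [kN, hb0, h]; simp
    field_simp
  · have hsa : s * a ≠ 0 := mul_ne_zero hs.ne' h
    rw [kN, if_neg hsa, show π * (s * a) / 2 = b by rw [hb]; ring,
      show π * (s * a) / (2 * N) = b / N by rw [hb]; field_simp, ← mul_sinc b,
      ← mul_sinc (b / N)]
    have hb0 : b ≠ 0 := by rw [hb]; have := hps.ne'; positivity
    have : Real.sinc (b / N) ≠ 0 := by linarith
    field_simp

open scoped Pointwise in
lemma smul_box (k : ℕ) (s : ℝ) (hs : 0 < s) :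
    s • box k = Set.univ.pi fun _ : Fin k => Set.Ioo (0 : ℝ) s := by
  ext x
  rw [Set.mem_smul_set_iff_inv_smul_mem₀ hs.ne']
  simp only [box, Set.mem_pi, Set.mem_univ, true_imp_iff, Set.mem_Ioo, Pi.smul_apply, smul_eq_mul]
  refine forall_congr' fun i => ?_
  rw [inv_mul_lt_iff₀ hs, mul_one, mul_pos_iff_of_pos_left (by positivity)]

lemma orthGapGF_eq (ε : ℝ) (N : ℕ) (s ξ : ℝ) (hs : 0 < s) (hN : π * s ≤ N) :
    orthGapGF ε N s ξ = fred ξ (mkKer ε (gN N) (cont_gN N) s) := by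
  rw [fred_eq, orthGapGF]
  congr 1
  ext k
  congr 1
  have h := Measure.setIntegral_comp_smul_of_pos volume
    (fun x : Fin k → ℝ => (Matrix.of fun i j : Fin k => orthKernel ε N (x i) (x j)).det)
    (box k) hs
  rw [smul_box k s hs] at h
  simp only [Module.finrank_fintype_fun_eq_card, Fintype.card_fin, smul_eq_mul] at h
  rw [inv_mul_eq_div, eq_div_iff (by positivity), mul_comm] at h
  rw [← h, ← integral_const_mul]
  refine setIntegral_congr_fun (MeasurableSet.univ_pi fun _ => measurableSet_Ioo) fun x hx => ?_
  have hd := Matrix.det_smul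
    (Matrix.of fun i j : Fin k => orthKernel ε N ((s • x) i) ((s • x) j)) s
  rw [Fintype.card_fin] at hd
  rw [← hd]
  congr 1
  ext i j
  have hp : ∀ i, ((prI (x i) : unitInterval) : ℝ) = x i := by
    intro i
    have := hx i (Set.mem_univ i)
    rw [prI, Set.projIcc_of_mem _ ⟨this.1.le, this.2.le⟩]
  have hi := hx i (Set.mem_univ i)
  have hj := hx j (Set.mem_univ j)
  rw [Set.mem_Ioo] at hi hj
  simp only [Matrix.smul_apply, Matrix.of_apply, mkKer_apply, hp, Pi.smul_apply, smul_eq_mul]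
  rw [← kN_profile N s (x i - x j) hs hN (by rw [abs_le]; constructor <;> linarith),
    ← kN_profile N s (x i + x j) hs hN (by rw [abs_le]; constructor <;> linarith), orthKernel]
  rw [show s * x i - s * x j = s * (x i - x j) by ring,
    show s * x i + s * x j = s * (x i + x j) by ring]
  ring

lemma rank_one_g1 (ε : ℝ) (hε : ε ∈ ({1, -1} : Set ℝ)) (s : ℝ) :
    ∃ u v : unitInterval → ℝ, ∀ p, mkKer ε g1 cont_g1 s p = u p.1 * v p.2 := by
  rcases hε with rfl | hε
  · refine ⟨fun x => Real.cos (π * s * x / 2), fun x => Real.cos (π * s * x / 2), fun p => ?_⟩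
    rw [mkKer_apply, g1, g1, show π * s * ((p.1 : ℝ) - p.2) / 2 =
      π * s * p.1 / 2 - π * s * p.2 / 2 by ring, show π * s * ((p.1 : ℝ) + p.2) / 2 =
      π * s * p.1 / 2 + π * s * p.2 / 2 by ring, Real.cos_add, Real.cos_sub]
    ring
  · rw [Set.mem_singleton_iff] at hε
    subst hε
    refine ⟨fun x => Real.sin (π * s * x / 2), fun x => Real.sin (π * s * x / 2), fun p => ?_⟩
    rw [mkKer_apply, g1, g1, show π * s * ((p.1 : ℝ) - p.2) / 2 =
      π * s * p.1 / 2 - π * s * p.2 / 2 by ring, show π * s * ((p.1 : ℝ) + p.2) / 2 =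
      π * s * p.1 / 2 + π * s * p.2 / 2 by ring, Real.cos_add, Real.cos_sub]
    ring

/-- Large-`N` expansion to order `N⁻²` of the orthogonal-group gap probability generating
functions, with the correction related to the limit by `G₁ = -(s²/6) ∂²G₀/∂s²`. -/
theorem orthogonal_gap_generating_function_expansion :
    ∀ ε ∈ ({1, -1} : Set ℝ),
      ∃ G₀ G₁ : ℝ → ℝ → ℝ,
        ∀ s : ℝ, 0 < s → ∀ ξ ∈ Set.Icc (0 : ℝ) 1,
          Tendsto (fun N : ℕ => orthGapGF ε N s ξ) atTop (𝓝 (G₀ s ξ)) ∧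
          Tendsto (fun N : ℕ => (N : ℝ) ^ 2 * (orthGapGF ε N s ξ - G₀ s ξ)) atTop
            (𝓝 (G₁ s ξ)) ∧
          DifferentiableAt ℝ (fun u => G₀ u ξ) s ∧
          DifferentiableAt ℝ (deriv fun u => G₀ u ξ) s ∧
          G₁ s ξ = -(s ^ 2 / 6) * deriv (deriv fun u => G₀ u ξ) s := by
  intro ε hε
  let K := mkKer ε g0 cont_g0
  let K' := mkKer ε g1 cont_g1
  let K'' := mkKer ε g2 cont_g2
  refine ⟨fun s ξ => fred ξ (K s), fun s ξ => fderiv ℝ (fred ξ) (K s) (-(s ^ 2 / 6) • K'' s), ?_⟩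
  intro s hs ξ _
  have dK : ∀ t, HasDerivAt K (K' t) t := hasDerivAt_mkKer ε g0 g1 cont_g0 cont_g1 deriv_g0
  have dK' : ∀ t, HasDerivAt K' (K'' t) t := hasDerivAt_mkKer ε g1 g2 cont_g1 cont_g2 deriv_g1
  have d1 : ∀ t, HasDerivAt (fun u => fred ξ (K u)) (fderiv ℝ (fred ξ) (K t) (K' t)) t :=
    fun t => (hasFDerivAt_fred ξ (K t)).comp_hasDerivAt t (dK t)
  have d1' : (deriv fun u => fred ξ (K u)) = fun t => fderiv ℝ (fred ξ) (K t) (K' t) :=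
    funext fun t => (d1 t).deriv
  have d2 : HasDerivAt (fun t => fderiv ℝ (fred ξ) (K t) (K' t))
      (fderiv ℝ (fred ξ) (K s) (K'' s)) s := by
    have h := HasFDerivAt.comp_hasDerivAt (f := K) (l := fderiv ℝ (fred ξ)) s
      (hasFDerivAt_fderiv_fred ξ (K s)) (dK s)
    refine (h.clm_apply (dK' s)).congr_deriv ?_
    obtain ⟨u, v, huv⟩ := rank_one_g1 ε hε s
    have hz := second_fderiv_rank_one ξ (K s) (K' s) u v huv
    rw [hz, zero_add]; rfl
  have hsq : Tendsto (fun N : ℕ => (N : ℝ) ^ 2) atTop atTop :=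
    (tendsto_pow_atTop (by norm_num)).comp tendsto_natCast_atTop_atTop
  have hinv : Tendsto (fun N : ℕ => ((N : ℝ) ^ 2)⁻¹) atTop (𝓝 0) :=
    tendsto_inv_atTop_zero.comp hsq
  have hne : ∀ᶠ N : ℕ in atTop, (N : ℝ) ^ 2 ≠ 0 := by
    filter_upwards [hsq.eventually_gt_atTop 0] with N hN using hN.ne'
  have hker := tendsto_ker ε s hs
  have hd0 : Tendsto (fun N : ℕ => mkKer ε (gN N) (cont_gN N) s - K s) atTop (𝓝 0) := by
    have := hinv.smul hker
    rw [zero_smul] at this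
    refine this.congr' ?_
    filter_upwards [hne] with N hN
    rw [inv_smul_smul₀ hN]
  have hii : Tendsto (fun N : ℕ => (N : ℝ) ^ 2 * (orthGapGF ε N s ξ - fred ξ (K s))) atTop
      (𝓝 (fderiv ℝ (fred ξ) (K s) (-(s ^ 2 / 6) • K'' s))) := by
    have := (hasFDerivAt_fred ξ (K s)).hasFDerivWithinAt (s := Set.univ) |>.lim hd0
      (Eventually.of_forall fun _ => Set.mem_univ _) hker
    refine this.congr' ?_
    filter_upwards [tendsto_natCast_atTop_atTop.eventually_ge_atTop (π * s)] with N hN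
    rw [orthGapGF_eq ε N s ξ hs hN, add_sub_cancel, smul_eq_mul]
  refine ⟨?_, hii, (d1 s).differentiableAt, ?_, ?_⟩
  · have := hinv.mul hii
    rw [zero_mul] at this
    have h2 := this.add_const (fred ξ (K s))
    rw [zero_add] at h2
    refine h2.congr' ?_
    filter_upwards [hne] with N hN
    rw [inv_mul_cancel_left₀ hN]; ring
  · rw [d1']; exact d2.differentiableAt
  · simp only
    rw [d1', d2.deriv, map_smul, smul_eq_mul]
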